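/- arXiv:1607.05490 — 6 statements merged into one kernel-verified Lean document; each statement's English description precedes it below -/
import Mathlib

section
/- Let d ≥ 2. If a function E : (Fin d × Fin d) → S into a finite set S is parity-oblivious (i.e., for every s ∈ S and all l, l' ∈ {0,…,d−1}, the cardinality of E⁻¹(s) ∩ P_l equals the cardinality of E⁻¹(s) ∩ P_{l'}), then the range of E has cardinality at most d. Equivalently, any deterministic encoding of Alice's string using more than d distinct symbols necessarily carries information about the parity x₁ ⊕_d x₂. -/
/-- For `l : Fin d`, the `l`-th parity class consists of pairs `(x₁, x₂)` with
`x₁ + x₂ ≡ l (mod d)`.  An encoding `E : Fin d × Fin d → S` is parity-oblivious if every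
symbol's fiber meets all parity classes in sets of equal cardinality. -/
def ParityOblivious {d : ℕ} {S : Type*} [DecidableEq S] (E : Fin d × Fin d → S) : Prop :=
  ∀ s : S, ∀ l l' : Fin d,
    (Finset.univ.filter fun x : Fin d × Fin d => E x = s ∧ x.1 + x.2 = l).card =
    (Finset.univ.filter fun x : Fin d × Fin d => E x = s ∧ x.1 + x.2 = l').card

/-- A parity-oblivious deterministic encoding uses at most `d` distinct symbols, i.e.
more than `1`-dit of information always carries some information about the parity. -/
theorem parityOblivious_range_card_le {d : ℕ} (hd : 2 ≤ d) {S : Type*} [Fintype S]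
    [DecidableEq S] (E : Fin d × Fin d → S) (hE : ParityOblivious E) :
    (Finset.univ.image E).card ≤ d := by
  have : NeZero d := ⟨by omega⟩
  have hsub : Finset.univ.image E ⊆ Finset.univ.image fun i : Fin d => E (i, -i) := by
    intro s hs
    obtain ⟨x, -, rfl⟩ := Finset.mem_image.mp hs
    have hpos : 0 < (Finset.univ.filter fun y : Fin d × Fin d =>
        E y = E x ∧ y.1 + y.2 = 0).card := by
      rw [hE (E x) 0 (x.1 + x.2)]
      exact Finset.card_pos.mpr ⟨x, by simp⟩
    obtain ⟨⟨a, b⟩, hy⟩ := Finset.card_pos.mp hpos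
    obtain ⟨hEy, hab⟩ := (Finset.mem_filter.mp hy).2
    obtain rfl : b = -a := (neg_eq_of_add_eq_zero_right hab).symm
    exact Finset.mem_image.mpr ⟨a, Finset.mem_univ a, hEy⟩
  calc (Finset.univ.image E).card
      ≤ (Finset.univ.image fun i : Fin d => E (i, -i)).card := Finset.card_le_card hsub
    _ ≤ (Finset.univ : Finset (Fin d)).card := Finset.card_image_le
    _ = d := Finset.card_fin d
end

section
/- (Theorem 1, upper bound.) Let d ≥ 2. For every finite set S, every parity-oblivious encoding E : (Fin d × Fin d) → S, and every pair of decoding functions D₁, D₂ : S → Fin d, the number of correct guesses ∑_{x ∈ Fin d × Fin d} ( [D₁(E x) = x₁] + [D₂(E x) = x₂] ) is at most d(d+1); equivalently, the average success probability (1/(2d²)) ∑_{x} ([D₁(E x)=x₁] + [D₂(E x)=x₂]) is at most (1/2)(1 + 1/d). -/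
/-- A parity-oblivious encoding uses at most `d` symbols, since each of them is used on the parity
class `P_0`, which has `d` elements. -/
theorem ParityOblivious.card_image_le {d : ℕ} {S : Type*} [DecidableEq S] (hd : 0 < d)
    {E : Fin d × Fin d → S} (hE : ParityOblivious E) : (Finset.univ.image E).card ≤ d := by
  obtain ⟨n, rfl⟩ : ∃ n, d = n + 1 := ⟨d - 1, by omega⟩
  have hsub : Finset.univ.image E ⊆ Finset.univ.image fun a : Fin (n + 1) => E (a, -a) := by
    intro s hs
    obtain ⟨x, -, hx⟩ := Finset.mem_image.1 hs
    have hpos : 0 < (Finset.univ.filter fun y : Fin (n + 1) × Fin (n + 1) =>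
        E y = s ∧ y.1 + y.2 = 0).card := by
      rw [hE s 0 (x.1 + x.2)]
      exact Finset.card_pos.2 ⟨x, by simp [hx]⟩
    obtain ⟨y, hy⟩ := Finset.card_pos.1 hpos
    obtain ⟨hys, hy0⟩ := (Finset.mem_filter.1 hy).2
    refine Finset.mem_image.2 ⟨y.1, Finset.mem_univ _, ?_⟩
    rw [neg_eq_of_add_eq_zero_right hy0]
    exact hys
  calc (Finset.univ.image E).card
      ≤ (Finset.univ.image fun a : Fin (n + 1) => E (a, -a)).card := Finset.card_le_card hsub
    _ ≤ n + 1 := Finset.card_image_le.trans_eq (Finset.card_fin _)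

/-- At most one input per used symbol has both of its coordinates decoded correctly. -/
theorem card_both_correct_le {d : ℕ} {S : Type*} [DecidableEq S] (E : Fin d × Fin d → S)
    (D₁ D₂ : S → Fin d) :
    (Finset.univ.filter fun x : Fin d × Fin d => D₁ (E x) = x.1 ∧ D₂ (E x) = x.2).card ≤
      (Finset.univ.image E).card := by
  refine Finset.card_le_card_of_injOn E (fun x _ => by simp) fun x hx y hy hxy => ?_
  obtain ⟨hx₁, hx₂⟩ := (Finset.mem_filter.1 hx).2
  obtain ⟨hy₁, hy₂⟩ := (Finset.mem_filter.1 hy).2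
  exact Prod.ext (by rw [← hx₁, ← hy₁, hxy]) (by rw [← hx₂, ← hy₂, hxy])

/-- The number of correct guesses of a parity-oblivious strategy is at most `d(d+1)`. -/
theorem ParityOblivious.sum_correct_le {d : ℕ} {S : Type*} [DecidableEq S] (hd : 0 < d)
    {E : Fin d × Fin d → S} (hE : ParityOblivious E) (D₁ D₂ : S → Fin d) :
    ∑ x : Fin d × Fin d,
      ((if D₁ (E x) = x.1 then 1 else 0) + (if D₂ (E x) = x.2 then 1 else 0)) ≤ d * (d + 1) := by
  calc ∑ x : Fin d × Fin d,
        ((if D₁ (E x) = x.1 then 1 else 0) + (if D₂ (E x) = x.2 then 1 else 0))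
      ≤ ∑ x : Fin d × Fin d, (1 + if D₁ (E x) = x.1 ∧ D₂ (E x) = x.2 then 1 else 0) := by
        refine Finset.sum_le_sum fun x _ => ?_
        by_cases h₁ : D₁ (E x) = x.1 <;> by_cases h₂ : D₂ (E x) = x.2 <;> simp [h₁, h₂]
    _ = d * d + (Finset.univ.filter fun x : Fin d × Fin d =>
          D₁ (E x) = x.1 ∧ D₂ (E x) = x.2).card := by
        simp [Finset.sum_add_distrib]
    _ ≤ d * d + d :=
        Nat.add_le_add_left ((card_both_correct_le E D₁ D₂).trans (hE.card_image_le hd)) _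
    _ = d * (d + 1) := by ring


/-- Theorem 1 (upper bound): any classical parity-oblivious strategy for the `d`-PORAC
game makes at most `d(d+1)` correct guesses, i.e. its average success probability is at
most `(1/2)(1 + 1/d)`. -/
theorem porac_classical_upper_bound {d : ℕ} (hd : 2 ≤ d) {S : Type*} [Fintype S]
    [DecidableEq S] (E : Fin d × Fin d → S) (hE : ParityOblivious E) (D₁ D₂ : S → Fin d) :
    (∑ x : Fin d × Fin d,
        ((if D₁ (E x) = x.1 then 1 else 0) + (if D₂ (E x) = x.2 then 1 else 0))
      ≤ d * (d + 1)) ∧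
    (1 / (2 * (d : ℝ) ^ 2)) * ∑ x : Fin d × Fin d,
        ((if D₁ (E x) = x.1 then (1 : ℝ) else 0) + (if D₂ (E x) = x.2 then (1 : ℝ) else 0))
      ≤ 1 / 2 * (1 + 1 / (d : ℝ)) := by
  have hsum := hE.sum_correct_le (by omega) D₁ D₂
  refine ⟨hsum, ?_⟩
  have hd0 : (0 : ℝ) < d := by exact_mod_cast (by omega : 0 < d)
  have hreal : ∑ x : Fin d × Fin d,
      ((if D₁ (E x) = x.1 then (1 : ℝ) else 0) + (if D₂ (E x) = x.2 then (1 : ℝ) else 0))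
      ≤ d * (d + 1) := by exact_mod_cast hsum
  calc _ ≤ 1 / (2 * (d : ℝ) ^ 2) * (d * (d + 1)) := by gcongr
    _ = 1 / 2 * (1 + 1 / (d : ℝ)) := by field_simp
end

section
/- (Theorem 1, achievability.) Let d ≥ 2. The encoding E : (Fin d × Fin d) → Fin d given by E(x₁,x₂) = x₁ is parity-oblivious, and with decoders D₁ = identity and D₂ any constant function, the number of correct guesses ∑_{x ∈ Fin d × Fin d} ( [D₁(E x) = x₁] + [D₂(E x) = x₂] ) equals exactly d(d+1), i.e., the average success probability equals (1/2)(1 + 1/d). -/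
/-- In the square of a finite additive group, each row meets each class of constant sum in
exactly one point. -/
theorem card_filter_fst_eq_and_add_eq {G : Type*} [AddCommGroup G] [Fintype G] [DecidableEq G]
    (s l : G) :
    (Finset.univ.filter fun x : G × G => x.1 = s ∧ x.1 + x.2 = l).card = 1 := by
  rw [Finset.card_eq_one]
  refine ⟨(s, l - s), ?_⟩
  ext ⟨a, b⟩
  simp only [Finset.mem_filter, Finset.mem_univ, true_and, Finset.mem_singleton, Prod.mk.injEq]
  refine and_congr_right fun h => ?_
  rw [h, eq_sub_iff_add_eq']

/-- Theorem 1 (achievability): the encoding `E(x₁,x₂) = x₁` is parity-oblivious and,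
decoding with `D₁ = id` and `D₂` any constant function, the number of correct guesses is
exactly `d(d+1)`, i.e. the average success probability equals `(1/2)(1 + 1/d)`. -/
theorem porac_classical_achievability {d : ℕ} (hd : 2 ≤ d) :
    ParityOblivious (fun x : Fin d × Fin d => x.1) ∧
    ∀ b : Fin d,
      (∑ x : Fin d × Fin d,
          ((if (fun s : Fin d => s) x.1 = x.1 then 1 else 0) +
            (if (fun _ : Fin d => b) x.1 = x.2 then 1 else 0))
        = d * (d + 1)) ∧
      (1 / (2 * (d : ℝ) ^ 2)) * ∑ x : Fin d × Fin d,
          ((if (fun s : Fin d => s) x.1 = x.1 then (1 : ℝ) else 0) +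
            (if (fun _ : Fin d => b) x.1 = x.2 then (1 : ℝ) else 0))
        = 1 / 2 * (1 + 1 / (d : ℝ)) := by
  have : NeZero d := ⟨by omega⟩
  have hd0 : (d : ℝ) ≠ 0 := Nat.cast_ne_zero.mpr (NeZero.ne d)
  refine ⟨fun s l l' => ?_, fun b => ⟨?_, ?_⟩⟩
  · rw [card_filter_fst_eq_and_add_eq, card_filter_fst_eq_and_add_eq]
  · rw [Fintype.sum_prod_type]
    simp [Finset.sum_add_distrib]
  · rw [Fintype.sum_prod_type]
    simp [Finset.sum_add_distrib]
    field_simp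
end

section
/- (Classical bound for the d-level random access code of string length 2.) Let d ≥ 2. For every encoding E : (Fin d × Fin d) → Fin d and every pair of decoders D₁, D₂ : Fin d → Fin d, the number of correct guesses ∑_{x ∈ Fin d × Fin d} ( [D₁(E x) = x₁] + [D₂(E x) = x₂] ) is at most d(d+1); equivalently, the average success probability is at most (1/2)(1 + 1/d). -/
/-- At most as many inputs are decoded correctly in both coordinates as there are messages. -/
theorem card_filter_decode_eq_le {α β γ : Type*} [Fintype α] [Fintype β] [Fintype γ]
    [DecidableEq α] [DecidableEq β] (E : α × β → γ) (D₁ : γ → α) (D₂ : γ → β) :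
    (Finset.univ.filter fun x : α × β => D₁ (E x) = x.1 ∧ D₂ (E x) = x.2).card
      ≤ Fintype.card γ := by
  refine Finset.card_le_card_of_injOn E (fun _ _ => Finset.mem_univ _) ?_
  intro x hx y hy hxy
  simp only [Finset.coe_filter, Finset.mem_univ, true_and, Set.mem_ofPred_eq] at hx hy
  exact Prod.ext (by rw [← hx.1, hxy, hy.1]) (by rw [← hx.2, hxy, hy.2])

/-- The number of correct guesses exceeds the number of inputs by at most the number of
messages. -/
theorem sum_correct_guesses_le {α β γ : Type*} [Fintype α] [Fintype β] [Fintype γ]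
    [DecidableEq α] [DecidableEq β] (E : α × β → γ) (D₁ : γ → α) (D₂ : γ → β) :
    ∑ x : α × β, ((if D₁ (E x) = x.1 then 1 else 0) + (if D₂ (E x) = x.2 then 1 else 0))
      ≤ Fintype.card α * Fintype.card β + Fintype.card γ := by
  calc
    _ ≤ ∑ x : α × β, (1 + if D₁ (E x) = x.1 ∧ D₂ (E x) = x.2 then 1 else 0) :=
      Finset.sum_le_sum fun x _ => by split_ifs <;> simp_all
    _ = Fintype.card α * Fintype.card β
        + (Finset.univ.filter fun x : α × β => D₁ (E x) = x.1 ∧ D₂ (E x) = x.2).card := by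
      rw [Finset.sum_add_distrib, Finset.card_filter]
      simp
    _ ≤ _ := by gcongr; exact card_filter_decode_eq_le E D₁ D₂

/-- Classical bound for the `d`-level random access code with string length 2: if Alice
may send one dit `E(x) ∈ Fin d`, then for any decoders `D₁, D₂` the number of correct
guesses is at most `d(d+1)`, i.e. the average success probability is at most
`(1/2)(1 + 1/d)`. -/
theorem drac_classical_bound {d : ℕ} (hd : 2 ≤ d)
    (E : Fin d × Fin d → Fin d) (D₁ D₂ : Fin d → Fin d) :
    (∑ x : Fin d × Fin d,
        ((if D₁ (E x) = x.1 then 1 else 0) + (if D₂ (E x) = x.2 then 1 else 0))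
      ≤ d * (d + 1)) ∧
    (1 / (2 * (d : ℝ) ^ 2)) * ∑ x : Fin d × Fin d,
        ((if D₁ (E x) = x.1 then (1 : ℝ) else 0) + (if D₂ (E x) = x.2 then (1 : ℝ) else 0))
      ≤ 1 / 2 * (1 + 1 / (d : ℝ)) := by
  have hcount : ∑ x : Fin d × Fin d,
      ((if D₁ (E x) = x.1 then 1 else 0) + (if D₂ (E x) = x.2 then 1 else 0))
        ≤ d * (d + 1) := by
    simpa only [Fintype.card_fin, mul_add_one] using sum_correct_guesses_le E D₁ D₂
  refine ⟨hcount, ?_⟩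
  have hd0 : (0 : ℝ) < d := by exact_mod_cast (by omega : 0 < d)
  have hreal : ∑ x : Fin d × Fin d,
      ((if D₁ (E x) = x.1 then (1 : ℝ) else 0) + (if D₂ (E x) = x.2 then (1 : ℝ) else 0))
        ≤ d * (d + 1) := by
    exact_mod_cast hcount
  calc
    _ ≤ 1 / (2 * (d : ℝ) ^ 2) * (d * (d + 1)) := by gcongr
    _ = 1 / 2 * (1 + 1 / (d : ℝ)) := by field_simp
end

section
/- Let d ≥ 2 and let q : (Fin d × Fin d) → ℝ be a probability distribution (q ≥ 0, ∑_x q(x) = 1) whose parity marginal is uniform, i.e., ∑_{x ∈ P_l} q(x) = 1/d for every l ∈ {0,…,d−1}. Then for all a, b ∈ Fin d, (∑_{x₂} q(a,x₂)) + (∑_{x₁} q(x₁,b)) ≤ 1 + 1/d. In particular, the sum of the maxima of the two one-dit marginals of q is at most 1 + 1/d. -/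
/-- If `q` is a probability distribution on `Fin d × Fin d` whose parity marginal is
uniform (each parity class `P_l = {(x₁,x₂) : x₁ + x₂ ≡ l (mod d)}` has total mass `1/d`),
then for all `a b`, the sum of the `a`-th row marginal and the `b`-th column marginal is
at most `1 + 1/d`. -/
theorem marginals_sum_le_of_uniform_parity {d : ℕ} (hd : 2 ≤ d)
    (q : Fin d × Fin d → ℝ) (hq0 : ∀ x, 0 ≤ q x) (hq1 : ∑ x : Fin d × Fin d, q x = 1)
    (hpar : ∀ l : Fin d,
      ∑ x ∈ Finset.univ.filter (fun x : Fin d × Fin d => x.1 + x.2 = l), q x = 1 / (d : ℝ)) :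
    ∀ a b : Fin d,
      (∑ x₂ : Fin d, q (a, x₂)) + (∑ x₁ : Fin d, q (x₁, b)) ≤ 1 + 1 / (d : ℝ) := by
  intro a b
  have row : ∑ x₂ : Fin d, q (a, x₂) = ∑ x : Fin d × Fin d, if x.1 = a then q x else 0 := by
    rw [Fintype.sum_prod_type, Finset.sum_comm]
    simp
  have col : ∑ x₁ : Fin d, q (x₁, b) = ∑ x : Fin d × Fin d, if x.2 = b then q x else 0 := by
    rw [Fintype.sum_prod_type]
    simp
  rw [row, col, ← hpar (a + b), ← hq1, Finset.sum_filter, ← Finset.sum_add_distrib,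
    ← Finset.sum_add_distrib]
  refine Finset.sum_le_sum fun x _ => ?_
  have hx := hq0 x
  by_cases h₁ : x.1 = a <;> by_cases h₂ : x.2 = b
  · simp [h₁, h₂]
  all_goals
    simp only [h₁, h₂, if_true, if_false]
    split_ifs <;> linarith
end

section
/- (Mathematical core of Theorem 2: randomized parity-oblivious strategies cannot beat the classical bound.) Let d ≥ 2, let Λ be a finite set, let p : (Fin d × Fin d) → Λ → ℝ satisfy p(x)(λ) ≥ 0 and ∑_{λ∈Λ} p(x)(λ) = 1 for every x, and suppose the parity-obliviousness condition holds at the level of Λ: for every λ ∈ Λ and all l, l' ∈ {0,…,d−1}, ∑_{x ∈ P_l} p(x)(λ) = ∑_{x ∈ P_{l'}} p(x)(λ). Then for any decoding distributions g₁, g₂ : Λ → Fin d → ℝ with g_y(λ) ≥ 0 and ∑_{b} g_y(λ)(b) = 1, the average success probability (1/(2d²)) ∑_{x ∈ (Fin d)²} ∑_{λ∈Λ} p(x)(λ) ( g₁(λ)(x₁) + g₂(λ)(x₂) ) is at most (1/2)(1 + 1/d). -/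
/-- If all parity classes have the same weight, no single point has more than `1 / d` of the
total weight. -/
theorem card_mul_le_sum_of_parity_oblivious {d : ℕ} (q : Fin d × Fin d → ℝ)
    (hq : ∀ x, 0 ≤ q x)
    (hpo : ∀ l l' : Fin d,
      ∑ x ∈ Finset.univ.filter (fun x : Fin d × Fin d => x.1 + x.2 = l), q x =
      ∑ x ∈ Finset.univ.filter (fun x : Fin d × Fin d => x.1 + x.2 = l'), q x)
    (y : Fin d × Fin d) : (d : ℝ) * q y ≤ ∑ x, q x := by
  have hle : q y ≤ ∑ x ∈ Finset.univ.filter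
      (fun x : Fin d × Fin d => x.1 + x.2 = y.1 + y.2), q x :=
    Finset.single_le_sum (f := q) (fun x _ => hq x) (by simp)
  rw [← Finset.sum_fiberwise Finset.univ (fun x : Fin d × Fin d => x.1 + x.2) q,
    Finset.sum_congr rfl (fun l _ => hpo l (y.1 + y.2)), Finset.sum_const, Finset.card_univ,
    Fintype.card_fin, nsmul_eq_mul]
  exact mul_le_mul_of_nonneg_left hle (Nat.cast_nonneg d)

/-- For weights with `d * q x ≤ ∑ q` everywhere, the weighted score of a pair of decoding
distributions is at most `(1 + 1 / d)` times the total weight. -/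
theorem card_mul_score_le {d : ℕ} (q : Fin d × Fin d → ℝ) (hq : ∀ x, 0 ≤ q x)
    (hle : ∀ y, (d : ℝ) * q y ≤ ∑ x, q x)
    (g₁ g₂ : Fin d → ℝ) (h₁0 : ∀ b, 0 ≤ g₁ b) (h₂0 : ∀ b, 0 ≤ g₂ b)
    (h₁1 : ∑ b, g₁ b = 1) (h₂1 : ∑ b, g₂ b = 1) :
    (d : ℝ) * ∑ x, q x * (g₁ x.1 + g₂ x.2) ≤ (d + 1) * ∑ x, q x := by
  have hg₁ : ∀ b, g₁ b ≤ 1 := fun b =>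
    h₁1 ▸ Finset.single_le_sum (f := g₁) (fun i _ => h₁0 i) (Finset.mem_univ b)
  have hg₂ : ∀ b, g₂ b ≤ 1 := fun b =>
    h₂1 ▸ Finset.single_le_sum (f := g₂) (fun i _ => h₂0 i) (Finset.mem_univ b)
  have hprod : ∑ x : Fin d × Fin d, g₁ x.1 * g₂ x.2 = 1 := by
    rw [Fintype.sum_prod_type, ← Finset.sum_mul_sum, h₁1, h₂1, one_mul]
  calc (d : ℝ) * ∑ x, q x * (g₁ x.1 + g₂ x.2)
      = ∑ x, (d : ℝ) * q x * (g₁ x.1 + g₂ x.2) := by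
        simp only [Finset.mul_sum, mul_assoc]
    _ ≤ ∑ x, (d * q x + (∑ z, q z) * (g₁ x.1 * g₂ x.2)) := by
        refine Finset.sum_le_sum fun x _ => ?_
        have hdq : (0 : ℝ) ≤ d * q x := mul_nonneg (Nat.cast_nonneg d) (hq x)
        have h := mul_nonneg hdq
          (mul_nonneg (sub_nonneg.2 (hg₁ x.1)) (sub_nonneg.2 (hg₂ x.2)))
        have h' := mul_le_mul_of_nonneg_right (hle x) (mul_nonneg (h₁0 x.1) (h₂0 x.2))
        linarith
    _ = (d + 1) * ∑ x, q x := by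
        rw [Finset.sum_add_distrib, ← Finset.mul_sum, ← Finset.mul_sum, hprod]
        ring


/-- Mathematical core of Theorem 2: in any preparation noncontextual (hidden-variable)
model, parity obliviousness holds at the level of the hidden variable `λ ∈ Λ`, and then
no randomized strategy for the `d`-PORAC game can beat the classical bound
`(1/2)(1 + 1/d)`.  Here `p x μ` is the probability of the hidden state `μ` given Alice's
input `x`, and `g₁ μ`, `g₂ μ` are Bob's decoding distributions for the two dits. -/
theorem porac_noncontextual_randomized_bound {d : ℕ} (hd : 2 ≤ d)
    {Λ : Type*} [Fintype Λ]
    (p : Fin d × Fin d → Λ → ℝ)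
    (hp0 : ∀ x μ, 0 ≤ p x μ)
    (hp1 : ∀ x, ∑ μ : Λ, p x μ = 1)
    (hpo : ∀ (μ : Λ) (l l' : Fin d),
      ∑ x ∈ Finset.univ.filter (fun x : Fin d × Fin d => x.1 + x.2 = l), p x μ =
      ∑ x ∈ Finset.univ.filter (fun x : Fin d × Fin d => x.1 + x.2 = l'), p x μ)
    (g₁ g₂ : Λ → Fin d → ℝ)
    (hg₁0 : ∀ μ b, 0 ≤ g₁ μ b) (hg₂0 : ∀ μ b, 0 ≤ g₂ μ b)
    (hg₁1 : ∀ μ, ∑ b : Fin d, g₁ μ b = 1) (hg₂1 : ∀ μ, ∑ b : Fin d, g₂ μ b = 1) :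
    (1 / (2 * (d : ℝ) ^ 2)) * ∑ x : Fin d × Fin d, ∑ μ : Λ,
        p x μ * (g₁ μ x.1 + g₂ μ x.2)
      ≤ 1 / 2 * (1 + 1 / (d : ℝ)) := by
  have hd0 : (0 : ℝ) < d := by exact_mod_cast (by omega : 0 < d)
  have hscore : (d : ℝ) * ∑ x : Fin d × Fin d, ∑ μ : Λ, p x μ * (g₁ μ x.1 + g₂ μ x.2)
      ≤ (d + 1) * (d * d) := by
    calc (d : ℝ) * ∑ x : Fin d × Fin d, ∑ μ : Λ, p x μ * (g₁ μ x.1 + g₂ μ x.2)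
        = ∑ μ : Λ, (d : ℝ) * ∑ x : Fin d × Fin d, p x μ * (g₁ μ x.1 + g₂ μ x.2) := by
          rw [Finset.sum_comm, Finset.mul_sum]
      _ ≤ ∑ μ : Λ, ((d : ℝ) + 1) * ∑ x : Fin d × Fin d, p x μ :=
          Finset.sum_le_sum fun μ _ => card_mul_score_le (fun x => p x μ) (fun x => hp0 x μ)
            (card_mul_le_sum_of_parity_oblivious _ (fun x => hp0 x μ) (hpo μ))
            (g₁ μ) (g₂ μ) (hg₁0 μ) (hg₂0 μ) (hg₁1 μ) (hg₂1 μ)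
      _ = (d + 1) * (d * d) := by
          rw [← Finset.mul_sum, Finset.sum_comm, Finset.sum_congr rfl (fun x _ => hp1 x)]
          simp
  have hS : ∑ x : Fin d × Fin d, ∑ μ : Λ, p x μ * (g₁ μ x.1 + g₂ μ x.2) ≤ (d + 1) * d :=
    le_of_mul_le_mul_left (by linarith) hd0
  calc _ ≤ 1 / (2 * (d : ℝ) ^ 2) * ((d + 1) * d) :=
        mul_le_mul_of_nonneg_left hS (by positivity)
    _ = 1 / 2 * (1 + 1 / (d : ℝ)) := by
        field_simp
end
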